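/- Let V be a finite-dimensional complex normed vector space, h a nonzero complex number, and let J : ℝ² → V be an infinitely differentiable function of (t₁,t₂) satisfying (with r₁ = e^{t₁}, r₂ = e^{t₂}): (1) h²∂₂²J − h²∂₁∂₂J − r₂J = 0 and (2) h²∂₁²J − r₁h∂₂J + r₁h∂₁J = 0. Then J also satisfies: (3) h³∂₁²∂₂J − r₁r₂J = 0 and (4) h³∂₁∂₂²J − r₂h∂₁J − r₁r₂J = 0. -/

import Mathlib

/-- Partial derivative with respect to the first variable. -/
noncomputable def pd1 {V : Type*} [NormedAddCommGroup V] [NormedSpace ℝ V]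
    (f : ℝ × ℝ → V) : ℝ × ℝ → V :=
  fun p => deriv (fun s => f (s, p.2)) p.1

/-- Partial derivative with respect to the second variable. -/
noncomputable def pd2 {V : Type*} [NormedAddCommGroup V] [NormedSpace ℝ V]
    (f : ℝ × ℝ → V) : ℝ × ℝ → V :=
  fun p => deriv (fun s => f (p.1, s)) p.2

section helpers
variable {V : Type*} [NormedAddCommGroup V] [NormedSpace ℝ V]

theorem aux_has1 {f : ℝ × ℝ → V} (hf : ContDiff ℝ (⊤ : ℕ∞) f) (p : ℝ × ℝ) :
    HasDerivAt (fun s => f (s, p.2)) (fderiv ℝ f p (1, 0)) p.1 := by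
  have h1 : HasFDerivAt f (fderiv ℝ f p) (p.1, p.2) :=
    (hf.differentiable (by simp) p).hasFDerivAt
  exact h1.comp_hasDerivAt p.1 ((hasDerivAt_id p.1).prodMk (hasDerivAt_const p.1 p.2))

theorem aux_has2 {f : ℝ × ℝ → V} (hf : ContDiff ℝ (⊤ : ℕ∞) f) (p : ℝ × ℝ) :
    HasDerivAt (fun s => f (p.1, s)) (fderiv ℝ f p (0, 1)) p.2 := by
  have h1 : HasFDerivAt f (fderiv ℝ f p) (p.1, p.2) :=
    (hf.differentiable (by simp) p).hasFDerivAt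
  exact h1.comp_hasDerivAt p.2 ((hasDerivAt_const p.2 p.1).prodMk (hasDerivAt_id p.2))

theorem aux_pd1 {f : ℝ × ℝ → V} (hf : ContDiff ℝ (⊤ : ℕ∞) f) :
    pd1 f = fun p => fderiv ℝ f p (1, 0) := funext fun p => (aux_has1 hf p).deriv

theorem aux_pd2 {f : ℝ × ℝ → V} (hf : ContDiff ℝ (⊤ : ℕ∞) f) :
    pd2 f = fun p => fderiv ℝ f p (0, 1) := funext fun p => (aux_has2 hf p).deriv

theorem aux_fd {f : ℝ × ℝ → V} (hf : ContDiff ℝ (⊤ : ℕ∞) f) :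
    ContDiff ℝ (⊤ : ℕ∞) (fderiv ℝ f) := hf.fderiv_right (by simp)

theorem aux_cd1 {f : ℝ × ℝ → V} (hf : ContDiff ℝ (⊤ : ℕ∞) f) :
    ContDiff ℝ (⊤ : ℕ∞) (pd1 f) := by
  rw [aux_pd1 hf]; exact (aux_fd hf).clm_apply contDiff_const

theorem aux_cd2 {f : ℝ × ℝ → V} (hf : ContDiff ℝ (⊤ : ℕ∞) f) :
    ContDiff ℝ (⊤ : ℕ∞) (pd2 f) := by
  rw [aux_pd2 hf]; exact (aux_fd hf).clm_apply contDiff_const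

theorem aux_hd1 {f : ℝ × ℝ → V} (hf : ContDiff ℝ (⊤ : ℕ∞) f) (p : ℝ × ℝ) :
    HasDerivAt (fun s => f (s, p.2)) (pd1 f p) p.1 := by
  rw [aux_pd1 hf]; exact aux_has1 hf p

theorem aux_hd2 {f : ℝ × ℝ → V} (hf : ContDiff ℝ (⊤ : ℕ∞) f) (p : ℝ × ℝ) :
    HasDerivAt (fun s => f (p.1, s)) (pd2 f p) p.2 := by
  rw [aux_pd2 hf]; exact aux_has2 hf p

theorem aux_comm {f : ℝ × ℝ → V} (hf : ContDiff ℝ (⊤ : ℕ∞) f) :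
    pd2 (pd1 f) = pd1 (pd2 f) := by
  funext p
  rw [aux_pd2 (aux_cd1 hf), aux_pd1 (aux_cd2 hf), aux_pd1 hf, aux_pd2 hf]
  have hd : DifferentiableAt ℝ (fderiv ℝ f) p := (aux_fd hf).differentiable (by simp) p
  have hsym : IsSymmSndFDerivAt ℝ f p := hf.contDiffAt.isSymmSndFDerivAt (by simpa using WithTop.coe_le_coe.2 (le_top : (2 : ℕ∞) ≤ ⊤))
  simp only [fderiv_clm_apply hd (differentiableAt_const _)]
  simpa using hsym (0, 1) (1, 0)

end helpers

theorem stmt_13 {V : Type*} [NormedAddCommGroup V] [NormedSpace ℂ V]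
    [FiniteDimensional ℂ V] (h : ℂ) (hh : h ≠ 0)
    (J : ℝ × ℝ → V) (hs : ContDiff ℝ (⊤ : ℕ∞) J)
    -- (1)  h²∂₂²J − h²∂₁∂₂J − r₂J = 0
    (e1 : ∀ p : ℝ × ℝ, h ^ 2 • pd2 (pd2 J) p - h ^ 2 • pd1 (pd2 J) p
        - (Real.exp p.2 : ℂ) • J p = 0)
    -- (2)  h²∂₁²J − r₁h∂₂J + r₁h∂₁J = 0
    (e2 : ∀ p : ℝ × ℝ, h ^ 2 • pd1 (pd1 J) p - ((Real.exp p.1 : ℂ) * h) • pd2 J p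
        + ((Real.exp p.1 : ℂ) * h) • pd1 J p = 0) :
    -- (3)  h³∂₁²∂₂J − r₁r₂J = 0
    (∀ p : ℝ × ℝ, h ^ 3 • pd1 (pd1 (pd2 J)) p
        - ((Real.exp p.1 : ℂ) * (Real.exp p.2 : ℂ)) • J p = 0) ∧
    -- (4)  h³∂₁∂₂²J − r₂h∂₁J − r₁r₂J = 0
    (∀ p : ℝ × ℝ, h ^ 3 • pd1 (pd2 (pd2 J)) p - ((Real.exp p.2 : ℂ) * h) • pd1 J p
        - ((Real.exp p.1 : ℂ) * (Real.exp p.2 : ℂ)) • J p = 0) := by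
  have c := aux_comm hs
  have h3 : ∀ p : ℝ × ℝ, h ^ 3 • pd1 (pd1 (pd2 J)) p
        - ((Real.exp p.1 : ℂ) * (Real.exp p.2 : ℂ)) • J p = 0 := by
    intro p
    have d := (((aux_hd2 (aux_cd1 (aux_cd1 hs)) p).const_smul (h ^ 2)).sub
      ((aux_hd2 (aux_cd2 hs) p).const_smul ((Real.exp p.1 : ℂ) * h))).add
      ((aux_hd2 (aux_cd1 hs) p).const_smul ((Real.exp p.1 : ℂ) * h))
    have z := d.unique ((hasDerivAt_const p.2 (0 : V)).congr_of_eventuallyEq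
      (Filter.Eventually.of_forall fun s => e2 (p.1, s)))
    rw [aux_comm (aux_cd1 hs), c] at z
    have e := e1 p
    linear_combination (norm := module) h • z + (Real.exp p.1 : ℂ) • e
  refine ⟨h3, fun p => ?_⟩
  have d := (((aux_hd1 (aux_cd2 (aux_cd2 hs)) p).const_smul (h ^ 2)).sub
      ((aux_hd1 (aux_cd1 (aux_cd2 hs)) p).const_smul (h ^ 2))).sub
      ((aux_hd1 hs p).const_smul (Real.exp p.2 : ℂ))
  have z := d.unique ((hasDerivAt_const p.1 (0 : V)).congr_of_eventuallyEq
      (Filter.Eventually.of_forall fun s => e1 (s, p.2)))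
  have e := h3 p
  linear_combination (norm := module) h • z + e
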